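/- Let d ≥ 1 be an integer, let L ≥ 0, and let Φ : ℝ^d → ℝ be twice continuously differentiable with Φ ≥ 0 and |ΔΦ(y)| ≤ L for all y ∈ ℝ^d, where ΔΦ is the Laplacian of Φ (the sum of the d second partial derivatives). Let 0 < a < 1 and let μ : ℝ^d → ℝ be measurable with μ ≥ 0 almost everywhere, ∫_{ℝ^d} μ dx = 1, ∫_{ℝ^d} μ Φ dx < ∞, and ∫_{ℝ^d} (μ − 1)_+ dx ≤ a. Then there exists a measurable function μ̃ : ℝ^d → ℝ with 0 ≤ μ̃ ≤ 1 almost everywhere, ∫_{ℝ^d} μ̃ dx = 1, and ∫_{ℝ^d} μ̃ Φ dx ≤ ∫_{ℝ^d} μ Φ dx + L·a. -/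

import Mathlib

open MeasureTheory

/-- The Laplacian of `Φ`: the sum of the second partial derivatives. -/
noncomputable def laplacian {d : ℕ} (Φ : EuclideanSpace ℝ (Fin d) → ℝ)
    (y : EuclideanSpace ℝ (Fin d)) : ℝ :=
  ∑ i, fderiv ℝ (fun z => fderiv ℝ Φ z (EuclideanSpace.single i 1)) y
    (EuclideanSpace.single i 1)

open Filter Topology

/-- Differentiation under the integral sign for averages over dilations against a compactly
supported kernel. -/
theorem hasDerivAt_integral_dilate {E : Type*} [NormedAddCommGroup E] [NormedSpace ℝ E]
    [MeasureSpace E] [BorelSpace E] [FiniteDimensional ℝ E]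
    [IsFiniteMeasureOnCompacts (volume : Measure E)]
    {Φ g : E → ℝ} (hΦ : ContDiff ℝ 1 Φ) (hg : Continuous g) (hgc : HasCompactSupport g)
    (x : E) (r : ℝ) :
    HasDerivAt (fun t : ℝ => ∫ y, Φ (x + t • y) * g y)
      (∫ y, fderiv ℝ Φ (x + r • y) y * g y) r := by
  have hΦc : Continuous Φ := hΦ.continuous
  have hΦ' : Continuous (fderiv ℝ Φ) := hΦ.continuous_fderiv one_ne_zero
  have hF' : Continuous fun p : ℝ × E => fderiv ℝ Φ (x + p.1 • p.2) p.2 * g p.2 := by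
    have : Continuous fun p : ℝ × E => fderiv ℝ Φ (x + p.1 • p.2) :=
      hΦ'.comp (by fun_prop)
    exact (this.clm_apply continuous_snd).mul (hg.comp continuous_snd)
  obtain ⟨C, hC⟩ := ((isCompact_closedBall r 1).prod hgc.isCompact).exists_bound_of_continuousOn
    hF'.continuousOn
  refine (hasDerivAt_integral_of_dominated_loc_of_deriv_le
    (F' := fun t y => fderiv ℝ Φ (x + t • y) y * g y)
    (bound := (tsupport g).indicator fun _ => C) (Metric.ball_mem_nhds r one_pos)
    (.of_forall fun t => ?_) ?_ ?_ (.of_forall fun y t ht => ?_) ?_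
    (.of_forall fun y t _ => ?_)).2
  · exact Continuous.aestronglyMeasurable (by fun_prop)
  · exact Continuous.integrable_of_hasCompactSupport (by fun_prop) hgc.mul_left
  · exact (hF'.comp (Continuous.prodMk_right r)).aestronglyMeasurable
  · by_cases hy : y ∈ tsupport g
    · simpa [hy] using hC (t, y) ⟨Metric.ball_subset_closedBall ht, hy⟩
    · simp [hy, image_eq_zero_of_notMem_tsupport hy]
  · exact (integrable_indicator_iff (isClosed_tsupport g).measurableSet).2
      (integrableOn_const hgc.isCompact.measure_lt_top.ne)
  · have h1 : HasDerivAt (fun t : ℝ => x + t • y) y t := by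
      simpa using ((hasDerivAt_id t).smul_const y).const_add x
    exact (((hΦ.differentiable one_ne_zero) _).hasFDerivAt.comp_hasDerivAt t h1).mul_const _

/-- A mean value inequality: averages of `Φ` against the radial kernel `y ↦ -2 κ' (‖y‖²)`, which
satisfies `y_i g(y) = - ∂ᵢ (κ (‖y‖²))`, are controlled by the Laplacian of `Φ`. -/
theorem integral_mul_radial_le {d : ℕ} {L : ℝ} {Φ : EuclideanSpace ℝ (Fin d) → ℝ}
    (hΦ : ContDiff ℝ 2 Φ) (hlap : ∀ y, laplacian Φ y ≤ L) {κ κ' : ℝ → ℝ}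
    (hκ : ∀ s, HasDerivAt κ (κ' s) s) (hκ' : Continuous κ') (hκ0 : ∀ s, 0 ≤ κ s) {N : ℝ}
    (hN : ∀ s, N ≤ s → κ s = 0) (hN' : ∀ s, N ≤ s → κ' s = 0)
    (x : EuclideanSpace ℝ (Fin d)) :
    Integrable (fun y => Φ (x + y) * (-2 * κ' (‖y‖ ^ 2))) ∧
    ∫ y, Φ (x + y) * (-2 * κ' (‖y‖ ^ 2)) ≤
      Φ x * (∫ y : EuclideanSpace ℝ (Fin d), -2 * κ' (‖y‖ ^ 2)) +
        L / 2 * ∫ y : EuclideanSpace ℝ (Fin d), κ (‖y‖ ^ 2) := by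
  set g : EuclideanSpace ℝ (Fin d) → ℝ := fun y => -2 * κ' (‖y‖ ^ 2) with hg
  set k : EuclideanSpace ℝ (Fin d) → ℝ := fun y => κ (‖y‖ ^ 2) with hk
  have hκc : Continuous κ := continuous_iff_continuousAt.2 fun s => (hκ s).continuousAt
  have hgcont : Continuous g := by fun_prop
  have hkcont : Continuous k := by fun_prop
  have hlarge : ∀ y : EuclideanSpace ℝ (Fin d), y ∉ Metric.closedBall 0 (Real.sqrt N) →
      N ≤ ‖y‖ ^ 2 := by
    intro y hy
    rw [mem_closedBall_zero_iff, not_le] at hy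
    exact (Real.sqrt_lt_sqrt_iff_of_pos (by
      have := (Real.sqrt_nonneg N).trans_lt hy; positivity)).1
      (by rwa [Real.sqrt_sq (norm_nonneg y)]) |>.le
  have hgc : HasCompactSupport g := HasCompactSupport.intro (isCompact_closedBall 0 (Real.sqrt N))
    fun y hy => by simp [hg, hN' _ (hlarge y hy)]
  have hkc : HasCompactSupport k := HasCompactSupport.intro (isCompact_closedBall 0 (Real.sqrt N))
    fun y hy => by simp [hk, hN _ (hlarge y hy)]
  have hkd : ∀ y, HasFDerivAt k (κ' (‖y‖ ^ 2) • (2 • innerSL ℝ y)) y := fun y =>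
    (hκ _).comp_hasFDerivAt y (hasStrictFDerivAt_norm_sq y).hasFDerivAt
  let e : Fin d → EuclideanSpace ℝ (Fin d) := fun i => EuclideanSpace.single i 1
  have hke : ∀ y i, fderiv ℝ k y (e i) = -(y i * g y) := by
    intro y i
    rw [(hkd y).fderiv]
    simp [e, hg, EuclideanSpace.inner_single_right]
    ring
  have hΦ1 : ∀ i, ContDiff ℝ 1 fun z => fderiv ℝ Φ z (e i) := fun i =>
    (hΦ.fderiv_right (m := 1) (by norm_num)).clm_apply contDiff_const
  have hΦ2 : ∀ i, Continuous fun z => fderiv ℝ (fun z => fderiv ℝ Φ z (e i)) z (e i) := fun i =>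
    ((hΦ1 i).continuous_fderiv one_ne_zero).clm_apply continuous_const
  have hparts : ∀ (r : ℝ) (i : Fin d),
      ∫ y, fderiv ℝ Φ (x + r • y) (e i) * (y i * g y) =
        r * ∫ y, fderiv ℝ (fun z => fderiv ℝ Φ z (e i)) (x + r • y) (e i) * k y := by
    intro r i
    have hf : ∀ y, HasFDerivAt (fun y => fderiv ℝ Φ (x + r • y) (e i))
        ((fderiv ℝ (fun z => fderiv ℝ Φ z (e i)) (x + r • y)).comp
          (r • ContinuousLinearMap.id ℝ _)) y := fun y =>
      (((hΦ1 i).differentiable one_ne_zero) _).hasFDerivAt.comp y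
        (((hasFDerivAt_id y).const_smul r).const_add x)
    have hc : Continuous fun y => fderiv ℝ Φ (x + r • y) (e i) :=
      (hΦ1 i).continuous.comp (by fun_prop)
    have hc2 : Continuous fun y => fderiv ℝ (fun z => fderiv ℝ Φ z (e i)) (x + r • y) (e i) :=
      (hΦ2 i).comp (by fun_prop)
    have hfe : ∀ y, fderiv ℝ (fun y => fderiv ℝ Φ (x + r • y) (e i)) y (e i) =
        r * fderiv ℝ (fun z => fderiv ℝ Φ z (e i)) (x + r • y) (e i) := fun y => by
      rw [(hf y).fderiv]; simp
    have := integral_mul_fderiv_eq_neg_fderiv_mul_of_integrable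
      (f := fun y => fderiv ℝ Φ (x + r • y) (e i)) (g := k) (v := e i) (μ := volume)
      (by
        simp_rw [hfe]
        exact Continuous.integrable_of_hasCompactSupport (by fun_prop) hkc.mul_left)
      (by
        simp_rw [hke]
        exact Continuous.integrable_of_hasCompactSupport (by fun_prop)
          (hgc.mul_left.neg.mul_left))
      (Continuous.integrable_of_hasCompactSupport (by fun_prop) hkc.mul_left)
      (fun y _ => (hf y).differentiableAt) (fun y _ => (hkd y).differentiableAt)
    simp_rw [hfe, hke, mul_neg, integral_neg, mul_assoc, integral_const_mul] at this
    exact neg_injective this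
  have hderiv : ∀ r : ℝ, ∫ y, fderiv ℝ Φ (x + r • y) y * g y =
      r * ∫ y, laplacian Φ (x + r • y) * k y := by
    intro r
    have h1 : ∀ y, fderiv ℝ Φ (x + r • y) y * g y =
        ∑ i, fderiv ℝ Φ (x + r • y) (e i) * (y i * g y) := by
      intro y
      have hy : y = ∑ i, y i • e i := by
        simpa [e] using ((EuclideanSpace.basisFun (Fin d) ℝ).sum_repr y).symm
      conv_lhs => rw [show fderiv ℝ Φ (x + r • y) y = fderiv ℝ Φ (x + r • y) (∑ i, y i • e i)
        by rw [← hy]]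
      rw [map_sum, Finset.sum_mul]
      refine Finset.sum_congr rfl fun i _ => ?_
      simp
      ring
    have h2 : ∀ y, laplacian Φ (x + r • y) * k y =
        ∑ i, fderiv ℝ (fun z => fderiv ℝ Φ z (e i)) (x + r • y) (e i) * k y := fun y => by
      rw [laplacian, Finset.sum_mul]
    simp_rw [h1, h2]
    rw [integral_finsetSum, integral_finsetSum, Finset.mul_sum]
    · exact Finset.sum_congr rfl fun i _ => hparts r i
    · intro i _
      have : Continuous fun y => fderiv ℝ (fun z => fderiv ℝ Φ z (e i)) (x + r • y) (e i) :=
        (hΦ2 i).comp (by fun_prop)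
      exact Continuous.integrable_of_hasCompactSupport (by fun_prop) hkc.mul_left
    · intro i _
      have : Continuous fun y => fderiv ℝ Φ (x + r • y) (e i) :=
        (hΦ1 i).continuous.comp (by fun_prop)
      exact Continuous.integrable_of_hasCompactSupport (by fun_prop) hgc.mul_left.mul_left
  have hk_int : Integrable k := hkcont.integrable_of_hasCompactSupport hkc
  have hlapc : Continuous (laplacian Φ) := continuous_finsetSum _ fun i _ => hΦ2 i
  have hbound : ∀ r : ℝ, ∫ y, laplacian Φ (x + r • y) * k y ≤ L * ∫ y, k y := by
    intro r
    rw [← integral_const_mul]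
    refine integral_mono (Continuous.integrable_of_hasCompactSupport (by fun_prop) hkc.mul_left)
      (hk_int.const_mul L) fun y => mul_le_mul_of_nonneg_right (hlap _) (hκ0 _)
  have hG := hasDerivAt_integral_dilate (hΦ.of_le one_le_two) hgcont hgc x
  have := image_le_of_deriv_right_le_deriv_boundary (a := 0) (b := 1)
    (f := fun r : ℝ => ∫ y, Φ (x + r • y) * g y)
    (B := fun r => Φ x * (∫ y, g y) + r ^ 2 / 2 * (L * ∫ y, k y))
    (B' := fun r => r * (L * ∫ y, k y))
    (fun r _ => (hG r).continuousAt.continuousWithinAt)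
    (fun r _ => (hG r).hasDerivWithinAt) (by simp [integral_const_mul])
    (by fun_prop)
    (fun r _ => by
      have := ((((hasDerivAt_id r).pow 2).div_const 2).mul_const
        (L * ∫ y, k y)).const_add (Φ x * ∫ y, g y)
      exact (this.congr_deriv (by simp)).hasDerivWithinAt)
    (fun r hr => by rw [hderiv]; exact mul_le_mul_of_nonneg_left (hbound r) hr.1)
    (Set.right_mem_Icc.2 zero_le_one)
  simp only [one_smul] at this
  exact ⟨Continuous.integrable_of_hasCompactSupport (by fun_prop) hgc.mul_left, by linarith⟩

/-- The density of the standard Gaussian measure on `ℝ^d`. -/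
noncomputable def stdGaussianDensity {d : ℕ} (y : EuclideanSpace ℝ (Fin d)) : ℝ :=
  ((2 * Real.pi) ^ (d / 2 : ℝ))⁻¹ * Real.exp (-(‖y‖ ^ 2 / 2))

theorem stdGaussianDensity_nonneg {d : ℕ} (y : EuclideanSpace ℝ (Fin d)) :
    0 ≤ stdGaussianDensity y := by
  unfold stdGaussianDensity; positivity

@[fun_prop]
theorem continuous_stdGaussianDensity {d : ℕ} :
    Continuous (stdGaussianDensity : EuclideanSpace ℝ (Fin d) → ℝ) := by
  unfold stdGaussianDensity; fun_prop

theorem stdGaussianDensity_le_half {d : ℕ} (hd : 1 ≤ d) (y : EuclideanSpace ℝ (Fin d)) :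
    stdGaussianDensity y ≤ 1 / 2 := by
  have hpi := Real.pi_gt_three
  have h2 : (2 : ℝ) ≤ (2 * Real.pi) ^ (d / 2 : ℝ) :=
    calc (2 : ℝ) ≤ Real.sqrt (2 * Real.pi) := Real.le_sqrt_of_sq_le (by linarith)
      _ = (2 * Real.pi) ^ (1 / 2 : ℝ) := Real.sqrt_eq_rpow _
      _ ≤ _ := Real.rpow_le_rpow_of_exponent_le (by linarith) (by
        have : (1 : ℝ) ≤ d := by exact_mod_cast hd
        linarith)
  calc stdGaussianDensity y ≤ 2⁻¹ * 1 := by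
        unfold stdGaussianDensity
        gcongr
        exact Real.exp_le_one_iff.2 (by have := sq_nonneg ‖y‖; linarith)
    _ = 1 / 2 := by norm_num

theorem integral_stdGaussianDensity {d : ℕ} :
    ∫ y : EuclideanSpace ℝ (Fin d), stdGaussianDensity y = 1 := by
  have h := GaussianFourier.integral_rexp_neg_mul_sq_norm (V := EuclideanSpace ℝ (Fin d))
    (b := 1 / 2) (by norm_num)
  have h' : ∀ y : EuclideanSpace ℝ (Fin d), stdGaussianDensity y =
      ((2 * Real.pi) ^ (d / 2 : ℝ))⁻¹ * Real.exp (-(1 / 2) * ‖y‖ ^ 2) := fun y => by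
    rw [stdGaussianDensity]; ring_nf
  simp_rw [h', integral_const_mul, h]
  rw [finrank_euclideanSpace_fin, show Real.pi / (1 / 2) = 2 * Real.pi by ring]
  exact inv_mul_cancel₀ (by positivity)

theorem integrable_stdGaussianDensity {d : ℕ} :
    Integrable (stdGaussianDensity : EuclideanSpace ℝ (Fin d) → ℝ) :=
  .of_integral_ne_zero (by simp [integral_stdGaussianDensity])

theorem lintegral_stdGaussianDensity {d : ℕ} :
    ∫⁻ y : EuclideanSpace ℝ (Fin d), ENNReal.ofReal (stdGaussianDensity y) = 1 := by
  rw [← ofReal_integral_eq_lintegral_ofReal integrable_stdGaussianDensity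
    (.of_forall stdGaussianDensity_nonneg), integral_stdGaussianDensity, ENNReal.ofReal_one]

theorem hasDerivAt_max_zero_sq (s : ℝ) :
    HasDerivAt (fun t : ℝ => max 0 t ^ 2) (2 * max 0 s) s := by
  rcases lt_trichotomy s 0 with hs | rfl | hs
  · rw [max_eq_left hs.le, mul_zero]
    refine (hasDerivAt_const s (0 : ℝ)).congr_of_eventuallyEq ?_
    filter_upwards [gt_mem_nhds hs] with t ht
    simp [max_eq_left ht.le]
  · rw [hasDerivAt_iff_isLittleO_nhds_zero]
    refine (Asymptotics.IsBigO.of_bound 1 (.of_forall fun h => ?_)).trans_isLittleO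
      (Asymptotics.isLittleO_pow_id (n := 2) one_lt_two)
    rcases le_total h 0 with hh | hh <;> simp [hh]
    positivity
  · rw [max_eq_right hs.le]
    refine ((hasDerivAt_pow 2 s).congr_of_eventuallyEq ?_).congr_deriv (by simp)
    filter_upwards [lt_mem_nhds hs] with t ht
    simp [max_eq_right ht.le]

/-- Averaging against a compactly supported truncation of the standard Gaussian. -/
theorem lintegral_mul_truncated_gaussian_le {d : ℕ} {L : ℝ} (hL : 0 ≤ L)
    {Φ : EuclideanSpace ℝ (Fin d) → ℝ} (hΦ : ContDiff ℝ 2 Φ) (hΦ0 : ∀ x, 0 ≤ Φ x)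
    (hlap : ∀ y, laplacian Φ y ≤ L) (x : EuclideanSpace ℝ (Fin d)) {N : ℝ} (hN : 0 < N) :
    ∫⁻ y, ENNReal.ofReal (Φ (x + y) * (stdGaussianDensity y * max 0 (1 - ‖y‖ ^ 2 / N) ^ 2)) ≤
      ENNReal.ofReal (Φ x * (1 + 4 / N) + L / 2) := by
  set P : ℝ := ((2 * Real.pi) ^ (d / 2 : ℝ))⁻¹ with hP
  have hP0 : 0 ≤ P := by positivity
  set κ : ℝ → ℝ := fun s => P * Real.exp (-(s / 2)) * max 0 (1 - s / N) ^ 2 with hκ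
  set κ' : ℝ → ℝ := fun s => -(P * Real.exp (-(s / 2)) *
    (max 0 (1 - s / N) ^ 2 / 2 + 2 / N * max 0 (1 - s / N))) with hκ'
  have hderiv : ∀ s, HasDerivAt κ (κ' s) s := by
    intro s
    have h1 : HasDerivAt (fun s : ℝ => P * Real.exp (-(s / 2)))
        (P * (Real.exp (-(s / 2)) * -(1 / 2))) s :=
      (((hasDerivAt_id s).div_const 2).neg.exp).const_mul P
    have h2 : HasDerivAt (fun s : ℝ => max 0 (1 - s / N) ^ 2)
        (2 * max 0 (1 - s / N) * -(1 / N)) s :=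
      HasDerivAt.comp (h := fun s => 1 - s / N) s (hasDerivAt_max_zero_sq (1 - s / N))
        (((hasDerivAt_id s).div_const N).const_sub 1)
    exact (h1.mul h2).congr_deriv (by simp only [hκ']; ring)
  have hcut : ∀ s, N ≤ s → max 0 (1 - s / N) = 0 := fun s hs =>
    max_eq_left (by rw [sub_nonpos]; exact (one_le_div hN).2 hs)
  have hcut1 : ∀ y : EuclideanSpace ℝ (Fin d), max 0 (1 - ‖y‖ ^ 2 / N) ≤ 1 := fun y =>
    max_le zero_le_one (sub_le_self 1 (by positivity))
  obtain ⟨hint, hle⟩ := integral_mul_radial_le hΦ hlap hderiv (by fun_prop)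
    (fun s => by positivity) (N := N) (fun s hs => by simp [hκ, hcut s hs])
    (fun s hs => by simp [hκ', hcut s hs]) x
  have hg : ∀ y : EuclideanSpace ℝ (Fin d), -2 * κ' (‖y‖ ^ 2) = stdGaussianDensity y *
      (max 0 (1 - ‖y‖ ^ 2 / N) ^ 2 + 4 / N * max 0 (1 - ‖y‖ ^ 2 / N)) := fun y => by
    simp only [hκ', stdGaussianDensity, ← hP]; ring
  have hk : ∀ y : EuclideanSpace ℝ (Fin d), κ (‖y‖ ^ 2) = stdGaussianDensity y *
      max 0 (1 - ‖y‖ ^ 2 / N) ^ 2 := fun y => rfl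
  simp_rw [hg, hk] at hint hle
  have hg1 : ∫ y : EuclideanSpace ℝ (Fin d), stdGaussianDensity y *
      (max 0 (1 - ‖y‖ ^ 2 / N) ^ 2 + 4 / N * max 0 (1 - ‖y‖ ^ 2 / N)) ≤ 1 + 4 / N := by
    refine (integral_mono_of_nonneg (.of_forall fun y => ?_)
      (integrable_stdGaussianDensity.mul_const (1 + 4 / N)) (.of_forall fun y => ?_)).trans_eq
      (by rw [integral_mul_const, integral_stdGaussianDensity, one_mul])
    · have := stdGaussianDensity_nonneg y
      simp only [Pi.zero_apply]
      positivity
    · refine mul_le_mul_of_nonneg_left (add_le_add (pow_le_one₀ (le_max_left _ _) (hcut1 y)) ?_)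
        (stdGaussianDensity_nonneg y)
      exact mul_le_of_le_one_right (by positivity) (hcut1 y)
  have hk1 : ∫ y : EuclideanSpace ℝ (Fin d), stdGaussianDensity y *
      max 0 (1 - ‖y‖ ^ 2 / N) ^ 2 ≤ 1 := by
    refine (integral_mono_of_nonneg (.of_forall fun y => ?_)
      integrable_stdGaussianDensity (.of_forall fun y => ?_)).trans_eq integral_stdGaussianDensity
    · exact mul_nonneg (stdGaussianDensity_nonneg y) (by positivity)
    · exact mul_le_of_le_one_right (stdGaussianDensity_nonneg y)
        (pow_le_one₀ (le_max_left _ _) (hcut1 y))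
  calc _ ≤ ∫⁻ y, ENNReal.ofReal (Φ (x + y) * (stdGaussianDensity y *
          (max 0 (1 - ‖y‖ ^ 2 / N) ^ 2 + 4 / N * max 0 (1 - ‖y‖ ^ 2 / N)))) := by
        refine lintegral_mono fun y => ENNReal.ofReal_le_ofReal ?_
        refine mul_le_mul_of_nonneg_left (mul_le_mul_of_nonneg_left ?_
          (stdGaussianDensity_nonneg y)) (hΦ0 _)
        exact le_add_of_nonneg_right (by positivity)
    _ = ENNReal.ofReal (∫ y, Φ (x + y) * (stdGaussianDensity y *
          (max 0 (1 - ‖y‖ ^ 2 / N) ^ 2 + 4 / N * max 0 (1 - ‖y‖ ^ 2 / N)))) := by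
        refine (ofReal_integral_eq_lintegral_ofReal hint (.of_forall fun y => ?_)).symm
        have := stdGaussianDensity_nonneg y
        have := hΦ0 (x + y)
        simp only [Pi.zero_apply]
        positivity
    _ ≤ _ := by
        refine ENNReal.ofReal_le_ofReal (hle.trans (add_le_add
          (mul_le_mul_of_nonneg_left hg1 (hΦ0 x)) ?_))
        exact mul_le_of_le_one_right (by positivity) hk1

/-- The Gaussian average of a nonnegative function with Laplacian at most `L` exceeds its value
at the centre by at most `L / 2`. -/
theorem lintegral_mul_stdGaussianDensity_le {d : ℕ} {L : ℝ} (hL : 0 ≤ L)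
    {Φ : EuclideanSpace ℝ (Fin d) → ℝ} (hΦ : ContDiff ℝ 2 Φ) (hΦ0 : ∀ x, 0 ≤ Φ x)
    (hlap : ∀ y, laplacian Φ y ≤ L) (x : EuclideanSpace ℝ (Fin d)) :
    ∫⁻ y, ENNReal.ofReal (Φ (x + y) * stdGaussianDensity y) ≤ ENNReal.ofReal (Φ x + L / 2) := by
  have hΦc := hΦ.continuous
  have hdiv : ∀ c : ℝ, Tendsto (fun n : ℕ => c / ((n : ℝ) + 1)) atTop (𝓝 0) := fun c => by
    simpa [div_eq_mul_inv] using tendsto_one_div_add_atTop_nhds_zero_nat.const_mul c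
  have hlim : ∀ y, Tendsto (fun n : ℕ => ENNReal.ofReal (Φ (x + y) * (stdGaussianDensity y *
      max 0 (1 - ‖y‖ ^ 2 / ((n : ℝ) + 1)) ^ 2))) atTop
      (𝓝 (ENNReal.ofReal (Φ (x + y) * stdGaussianDensity y))) := fun y => by
    refine ENNReal.tendsto_ofReal ?_
    have h := ((tendsto_const_nhds (x := (0 : ℝ))).max ((hdiv (‖y‖ ^ 2)).const_sub 1)).pow 2
    simpa using (h.const_mul (stdGaussianDensity y)).const_mul (Φ (x + y))
  have hlim' : Tendsto (fun n : ℕ => ENNReal.ofReal (Φ x * (1 + 4 / ((n : ℝ) + 1)) + L / 2))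
      atTop (𝓝 (ENNReal.ofReal (Φ x + L / 2))) := by
    refine ENNReal.tendsto_ofReal ?_
    simpa using (((hdiv 4).const_add 1).const_mul (Φ x)).add_const (L / 2)
  calc _ = ∫⁻ y, liminf (fun n : ℕ => ENNReal.ofReal (Φ (x + y) * (stdGaussianDensity y *
        max 0 (1 - ‖y‖ ^ 2 / ((n : ℝ) + 1)) ^ 2))) atTop :=
        lintegral_congr fun y => (hlim y).liminf_eq.symm
    _ ≤ liminf (fun n : ℕ => ∫⁻ y, ENNReal.ofReal (Φ (x + y) * (stdGaussianDensity y *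
        max 0 (1 - ‖y‖ ^ 2 / ((n : ℝ) + 1)) ^ 2))) atTop :=
        lintegral_liminf_le fun n => (Continuous.measurable (by fun_prop)).ennreal_ofReal
    _ ≤ liminf (fun n : ℕ => ENNReal.ofReal (Φ x * (1 + 4 / ((n : ℝ) + 1)) + L / 2)) atTop :=
        liminf_le_liminf (.of_forall fun n =>
          lintegral_mul_truncated_gaussian_le hL hΦ hΦ0 hlap x (by positivity))
    _ = _ := hlim'.liminf_eq

theorem lintegral_gaussian_convolution_mul {d : ℕ}
    {ν φ : EuclideanSpace ℝ (Fin d) → ENNReal} (hν : Measurable ν) (hφ : Measurable φ) :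
    ∫⁻ y, (∫⁻ x, ν x * ENNReal.ofReal (stdGaussianDensity (y - x))) * φ y =
      ∫⁻ x, ν x * ∫⁻ y, φ (x + y) * ENNReal.ofReal (stdGaussianDensity y) := by
  have hp : Measurable fun z : EuclideanSpace ℝ (Fin d) =>
      ENNReal.ofReal (stdGaussianDensity z) := by fun_prop
  have hpair : Measurable fun z : EuclideanSpace ℝ (Fin d) × EuclideanSpace ℝ (Fin d) =>
      ν z.2 * ENNReal.ofReal (stdGaussianDensity (z.1 - z.2)) * φ z.1 :=
    ((hν.comp measurable_snd).mul
      (hp.comp (measurable_fst.sub measurable_snd))).mul (hφ.comp measurable_fst)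
  calc _ = ∫⁻ y, ∫⁻ x, ν x * ENNReal.ofReal (stdGaussianDensity (y - x)) * φ y := by
        refine lintegral_congr fun y => (lintegral_mul_const _ ?_).symm
        exact hν.mul (hp.comp (measurable_const.sub measurable_id))
    _ = ∫⁻ x, ∫⁻ y, ν x * ENNReal.ofReal (stdGaussianDensity (y - x)) * φ y :=
        lintegral_lintegral_swap hpair.aemeasurable
    _ = _ := by
        refine lintegral_congr fun x => ?_
        rw [← lintegral_add_left_eq_self _ x, ← lintegral_const_mul]
        · refine lintegral_congr fun y => ?_
          rw [add_sub_cancel_left]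
          ring
        · exact (hφ.comp (measurable_const.add measurable_id)).mul hp

/-- Lowering the truncation level from `1` to `1 - a` adds at most `a` to the excess mass. -/
theorem lintegral_excess_le {α : Type*} [MeasurableSpace α] {m : Measure α} {a : ℝ} (ha0 : 0 ≤ a)
    (ha1 : a ≤ 1) {μ : α → ℝ} (hμ : Measurable μ)
    (hmass : ∫⁻ x, ENNReal.ofReal (μ x) ∂m = 1)
    (hexcess : ∫⁻ x, ENNReal.ofReal (max (μ x - 1) 0) ∂m ≤ ENNReal.ofReal a) :
    ∫⁻ x, ENNReal.ofReal (μ x - (1 - a)) ∂m ≤ ENNReal.ofReal (2 * a) :=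
  calc _ ≤ ∫⁻ x, (ENNReal.ofReal (max (μ x - 1) 0) +
          ENNReal.ofReal a * ENNReal.ofReal (μ x)) ∂m := by
        refine lintegral_mono fun x => ?_
        rcases le_total (μ x) (1 - a) with h | h
        · simp [ENNReal.ofReal_of_nonpos (sub_nonpos.2 h)]
        · have hx : 0 ≤ μ x := by linarith
          rw [← ENNReal.ofReal_mul ha0, ← ENNReal.ofReal_add (le_max_right _ _) (by positivity)]
          refine ENNReal.ofReal_le_ofReal ?_
          rcases le_total (μ x) 1 with h1 | h1
          · nlinarith [le_max_right (μ x - 1) 0]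
          · nlinarith [le_max_left (μ x - 1) 0]
    _ ≤ ENNReal.ofReal a + ENNReal.ofReal a * 1 := by
        rw [lintegral_add_right _ (by fun_prop), lintegral_const_mul _ (by fun_prop), hmass]
        gcongr
    _ = ENNReal.ofReal (2 * a) := by
        rw [mul_one, ← ENNReal.ofReal_add ha0 ha0, two_mul]

theorem ofReal_min_add_ofReal_sub {s t : ℝ} (ht : 0 ≤ t) :
    ENNReal.ofReal (min s t) + ENNReal.ofReal (s - t) = ENNReal.ofReal s := by
  rcases le_total s t with h | h
  · simp [h]
  · rw [min_eq_right h, ← ENNReal.ofReal_add ht (sub_nonneg.2 h), add_sub_cancel]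

/-- Existence and potential-energy part of Lemma 4.2 of the paper: a density `μ`
of mass 1 with excess mass at most `a` above level 1 can be replaced by a density
`μ̃ ≤ 1` of mass 1 whose potential energy exceeds that of `μ` by at most `L a`. -/
theorem approximate_density_below_one (d : ℕ) (hd : 1 ≤ d) (L : ℝ) (hL : 0 ≤ L)
    (Φ : EuclideanSpace ℝ (Fin d) → ℝ) (hΦ : ContDiff ℝ 2 Φ)
    (hΦ0 : ∀ x, 0 ≤ Φ x) (hlap : ∀ y, |laplacian Φ y| ≤ L)
    (a : ℝ) (ha0 : 0 < a) (ha1 : a < 1)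
    (μ : EuclideanSpace ℝ (Fin d) → ℝ) (hmeas : Measurable μ)
    (hpos : ∀ᵐ x ∂volume, 0 ≤ μ x)
    (hmass : ∫⁻ x, ENNReal.ofReal (μ x) ∂volume = 1)
    (henergy : ∫⁻ x, ENNReal.ofReal (μ x * Φ x) ∂volume < ⊤)
    (hexcess : ∫⁻ x, ENNReal.ofReal (max (μ x - 1) 0) ∂volume ≤ ENNReal.ofReal a) :
    ∃ μt : EuclideanSpace ℝ (Fin d) → ℝ, Measurable μt ∧
      (∀ᵐ x ∂volume, 0 ≤ μt x) ∧ (∀ᵐ x ∂volume, μt x ≤ 1) ∧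
      (∫⁻ x, ENNReal.ofReal (μt x) ∂volume = 1) ∧
      ∫⁻ x, ENNReal.ofReal (μt x * Φ x) ∂volume
        ≤ (∫⁻ x, ENNReal.ofReal (μ x * Φ x) ∂volume) + ENNReal.ofReal (L * a) := by
  set ν : EuclideanSpace ℝ (Fin d) → ENNReal := fun x => ENNReal.ofReal (μ x - (1 - a))
  set τ : EuclideanSpace ℝ (Fin d) → ENNReal := fun x => ENNReal.ofReal (min (μ x) (1 - a))
  set φ : EuclideanSpace ℝ (Fin d) → ENNReal := fun x => ENNReal.ofReal (Φ x) with hφ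
  set c : EuclideanSpace ℝ (Fin d) → ENNReal := fun y =>
    ∫⁻ x, ν x * ENNReal.ofReal (stdGaussianDensity (y - x))
  have hνm : Measurable ν := by fun_prop
  have hτm : Measurable τ := by fun_prop
  have hφm : Measurable φ := hΦ.continuous.measurable.ennreal_ofReal
  have hνφm : Measurable fun x => ν x * φ x := hνm.mul hφm
  have hτφm : Measurable fun x => τ x * φ x := hτm.mul hφm
  have hcm : Measurable c := by
    refine Measurable.lintegral_prod_right' (f := fun z =>
      ν z.2 * ENNReal.ofReal (stdGaussianDensity (z.1 - z.2))) ?_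
    exact (hνm.comp measurable_snd).mul (by fun_prop)
  have hsplit : ∀ x, τ x + ν x = ENNReal.ofReal (μ x) := fun x =>
    ofReal_min_add_ofReal_sub (by linarith)
  have hνmass : ∫⁻ x, ν x ≤ ENNReal.ofReal (2 * a) :=
    lintegral_excess_le ha0.le ha1.le hmeas hmass hexcess
  have hca : ∀ y, c y ≤ ENNReal.ofReal a := fun y =>
    calc c y ≤ ∫⁻ x, ν x * ENNReal.ofReal (1 / 2) := by
          refine lintegral_mono fun x => ?_
          gcongr
          exact stdGaussianDensity_le_half hd _
      _ = (∫⁻ x, ν x) * ENNReal.ofReal (1 / 2) := lintegral_mul_const _ hνm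
      _ ≤ ENNReal.ofReal (2 * a) * ENNReal.ofReal (1 / 2) := by gcongr
      _ = ENNReal.ofReal a := by
          rw [← ENNReal.ofReal_mul (by positivity)]
          ring_nf
  have hcmass : ∫⁻ y, c y = ∫⁻ x, ν x := by
    simpa [lintegral_stdGaussianDensity] using
      lintegral_gaussian_convolution_mul hνm (φ := fun _ => 1) measurable_const
  have hcenergy : ∫⁻ y, c y * φ y ≤ (∫⁻ x, ν x * φ x) + ENNReal.ofReal (L * a) :=
    calc ∫⁻ y, c y * φ y
        = ∫⁻ x, ν x * ∫⁻ y, φ (x + y) * ENNReal.ofReal (stdGaussianDensity y) :=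
          lintegral_gaussian_convolution_mul hνm hφm
      _ ≤ ∫⁻ x, (ν x * φ x + ν x * ENNReal.ofReal (L / 2)) := by
          refine lintegral_mono fun x => ?_
          rw [← mul_add, hφ, ← ENNReal.ofReal_add (hΦ0 x) (by positivity)]
          gcongr
          simp_rw [← ENNReal.ofReal_mul (hΦ0 _)]
          exact lintegral_mul_stdGaussianDensity_le hL hΦ hΦ0
            (fun y => (le_abs_self _).trans (hlap y)) x
      _ = (∫⁻ x, ν x * φ x) + (∫⁻ x, ν x) * ENNReal.ofReal (L / 2) := by
          rw [lintegral_add_left hνφm, lintegral_mul_const _ hνm]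
      _ ≤ (∫⁻ x, ν x * φ x) + ENNReal.ofReal (2 * a) * ENNReal.ofReal (L / 2) := by gcongr
      _ = _ := by
          rw [← ENNReal.ofReal_mul (by positivity)]
          ring_nf
  have hμt : ∀ y, ENNReal.ofReal ((τ y + c y).toReal) = τ y + c y := fun y =>
    ENNReal.ofReal_toReal
      (ENNReal.add_ne_top.2 ⟨ENNReal.ofReal_ne_top, ((hca y).trans_lt ENNReal.ofReal_lt_top).ne⟩)
  refine ⟨fun y => (τ y + c y).toReal, (hτm.add hcm).ennreal_toReal,
    .of_forall fun y => ENNReal.toReal_nonneg, .of_forall fun y => ?_, ?_, ?_⟩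
  · refine ENNReal.toReal_le_of_le_ofReal zero_le_one ?_
    calc τ y + c y ≤ ENNReal.ofReal (1 - a) + ENNReal.ofReal a :=
          add_le_add (ENNReal.ofReal_le_ofReal (min_le_right _ _)) (hca y)
      _ = ENNReal.ofReal 1 := by
          rw [← ENNReal.ofReal_add (by linarith) ha0.le, sub_add_cancel]
  · simp_rw [hμt]
    rw [lintegral_add_left hτm, hcmass, ← lintegral_add_left hτm]
    simp_rw [hsplit, hmass]
  · calc ∫⁻ y, ENNReal.ofReal ((τ y + c y).toReal * Φ y)
        = (∫⁻ y, τ y * φ y) + ∫⁻ y, c y * φ y := by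
          rw [← lintegral_add_left hτφm]
          refine lintegral_congr fun y => ?_
          rw [ENNReal.ofReal_mul ENNReal.toReal_nonneg, hμt, add_mul]
      _ ≤ (∫⁻ y, τ y * φ y) + ((∫⁻ x, ν x * φ x) + ENNReal.ofReal (L * a)) := by gcongr
      _ = _ := by
          rw [← add_assoc, ← lintegral_add_left hτφm]
          simp_rw [← add_mul, hsplit, hφ, ← ENNReal.ofReal_mul' (hΦ0 _)]
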